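/- Lemma: Fix k ≥ 2. Let P be a rook placement on a (not necessarily rectangular) Ferrers board containing the pattern k…1, let S be the value-smallest occurrence of k…1 in P, and set b = row(S₁) and a = col(S_k). Then for R₁ = R(a, b−1), ins(P|_{R₁}) = ins(φ(P)|_{R₁}), and for R₂ = R(a−1, b), rec(P|_{R₂}) = rec(φ(P)|_{R₂}). -/

import Mathlib

open scoped Classical

/-- A cell (square) of the grid: `(column, row)`, both `≥ 1` for genuine cells. -/
abbrev Cell : Type := ℕ × ℕ

/-- The rectangle `R(a,b)` consisting of all cells `(i,j)` with `1 ≤ i ≤ a`, `1 ≤ j ≤ b`. -/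
def Rect (a b : ℕ) : Finset Cell := Finset.Icc 1 a ×ˢ Finset.Icc 1 b

/-- A Ferrers board (French notation): a down-left closed finite set of cells with
positive coordinates. -/
def IsFerrers (F : Finset Cell) : Prop :=
  ∀ p ∈ F, 1 ≤ p.1 ∧ 1 ≤ p.2 ∧
    ∀ q : Cell, 1 ≤ q.1 → 1 ≤ q.2 → q.1 ≤ p.1 → q.2 ≤ p.2 → q ∈ F

/-- A rook placement on a board `F`: a subset of `F` with at most one cell in each
column and at most one cell in each row. -/
def IsPlacement (F P : Finset Cell) : Prop :=
  P ⊆ F ∧ (∀ p ∈ P, ∀ q ∈ P, p.1 = q.1 → p = q) ∧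
    (∀ p ∈ P, ∀ q ∈ P, p.2 = q.2 → p = q)

/-- A decreasing sequence in `P`: columns strictly increase, rows strictly decrease. -/
def IsDecSeq (P : Finset Cell) (k : ℕ) (S : Fin k → Cell) : Prop :=
  (∀ i, S i ∈ P) ∧ ∀ i j : Fin k, i < j → (S i).1 < (S j).1 ∧ (S j).2 < (S i).2

/-- An increasing sequence in `P`: columns and rows both strictly increase. -/
def IsIncSeq (P : Finset Cell) (k : ℕ) (S : Fin k → Cell) : Prop :=
  (∀ i, S i ∈ P) ∧ ∀ i j : Fin k, i < j → (S i).1 < (S j).1 ∧ (S i).2 < (S j).2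

/-- Lexicographic comparison of two sequences of cells by their rows (values),
entry by entry from the left. -/
def rowLexLE (k : ℕ) (S T : Fin k → Cell) : Prop :=
  (∀ i, (S i).2 = (T i).2) ∨
    ∃ i : Fin k, (S i).2 < (T i).2 ∧ ∀ j : Fin k, j < i → (S j).2 = (T j).2

/-- An occurrence of the decreasing pattern `k…1` in the placement `P` on the board `F`:
a decreasing sequence of cells of `P`, all lying in a common rectangle contained in `F`. -/
def IsDecOcc (F P : Finset Cell) (k : ℕ) (D : Fin k → Cell) : Prop :=
  IsDecSeq P k D ∧ ∃ a b : ℕ, Rect a b ⊆ F ∧ ∀ i, D i ∈ Rect a b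

/-- `D` is the lexicographically value-smallest occurrence of `k…1` in `P`. -/
def IsMinOcc (F P : Finset Cell) (k : ℕ) (D : Fin k → Cell) : Prop :=
  IsDecOcc F P k D ∧ ∀ S : Fin k → Cell, IsDecOcc F P k S → rowLexLE k D S

/-- Cyclic successor on `Fin k`. -/
def cyc (k : ℕ) (i : Fin k) : Fin k :=
  ⟨(i.1 + 1) % k, Nat.mod_lt _ (Nat.lt_of_le_of_lt (Nat.zero_le _) i.isLt)⟩

/-- The action of `φ` on `P`, given the occurrence `D = D₁…D_k` of `k…1`: the columns of
`D₁,…,D_k` receive markers at the rows of `D₂,…,D_k,D₁` respectively; other cells are fixed. -/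
def phiStep (k : ℕ) (D : Fin k → Cell) (P : Finset Cell) : Finset Cell :=
  (P \ Finset.image D Finset.univ) ∪
    Finset.image (fun i : Fin k => ((D i).1, (D (cyc k i)).2)) Finset.univ

/-- Robinson–Schensted row insertion of a value `v` into one row: returns the new row
and the bumped value (`none` if `v` was appended at the right end). The leftmost entry
strictly larger than `v` is bumped. -/
def rowInsert (v : ℕ) : List ℕ → List ℕ × Option ℕ
  | [] => ([v], none)
  | x :: xs =>
    if v < x then (v :: xs, some x)
    else
      let p := rowInsert v xs
      (x :: p.1, p.2)

/-- Robinson–Schensted insertion of a value into a tableau (a list of rows, top row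
first), bumping cascading down the rows. -/
def tabInsert (v : ℕ) : List (List ℕ) → List (List ℕ)
  | [] => [[v]]
  | row :: rest =>
    match rowInsert v row with
    | (r, none) => r :: rest
    | (r, some b) => r :: tabInsert b rest

/-- The row of the (unique) cell of `P` in column `c`. -/
noncomputable def rowAt (P : Finset Cell) (c : ℕ) : ℕ := sSup {r | (c, r) ∈ P}

/-- The cells of the placement `P`, as (column, row) pairs listed in increasing order
of column: the two-line notation of the corresponding partial permutation. -/
noncomputable def rsSteps (P : Finset Cell) : List (ℕ × ℕ) :=
  ((P.image Prod.fst).sort (· ≤ ·)).map fun c => (c, rowAt P c)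

/-- The index of the (first) row where two tableaux have different lengths. -/
noncomputable def diffRow (T T' : List (List ℕ)) : ℕ :=
  sInf {r | (T.getD r []).length ≠ (T'.getD r []).length}

/-- Append the value `v` at the right end of row `r` of a tableau (creating a new
bottom row when `r` is one past the last row). -/
def placeAt (v : ℕ) : ℕ → List (List ℕ) → List (List ℕ)
  | 0, [] => [[v]]
  | 0, row :: rest => (row ++ [v]) :: rest
  | _ + 1, [] => [[v]]
  | r + 1, row :: rest => row :: placeAt v r rest

/-- The Robinson–Schensted insertion and recording tableaux of the partial permutation
determined by `P`, columns processed in increasing order. -/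
noncomputable def rsPair (P : Finset Cell) : List (List ℕ) × List (List ℕ) :=
  (rsSteps P).foldl
    (fun TR cv =>
      let T' := tabInsert cv.2 TR.1
      (T', placeAt cv.1 (diffRow TR.1 T') TR.2))
    ([], [])

/-- The Robinson–Schensted insertion tableau `ins(P)`. -/
noncomputable def insTab (P : Finset Cell) : List (List ℕ) := (rsPair P).1

/-- The Robinson–Schensted recording tableau `rec(P)`. -/
noncomputable def recTab (P : Finset Cell) : List (List ℕ) := (rsPair P).2

/-- Entrywise lexicographic comparison of lists, the first list being the smaller one. -/
def LexLE : List ℕ → List ℕ → Prop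
  | [], _ => True
  | _ :: _, [] => False
  | x :: xs, y :: ys => x < y ∨ x = y ∧ LexLE xs ys

/-- `rs` is the lexicographically smallest strictly decreasing subsequence of `w` of its length
with entries below `B`, and no longer such subsequence exists. -/
structure IsLead (B : ℕ) (rs w : List ℕ) : Prop where
  sub : rs.Sublist w
  dec : rs.Pairwise (· > ·)
  bdd : ∀ r ∈ rs, r < B
  min : ∀ ts : List ℕ, ts.Sublist w → ts.Pairwise (· > ·) → (∀ t ∈ ts, t < B) →
    ts.length = rs.length → LexLE rs ts
  short : ∀ ts : List ℕ, ts.Sublist w → ts.Pairwise (· > ·) → (∀ t ∈ ts, t < B) →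
    ts.length ≠ rs.length + 1

/-- The first row after row-inserting the values of `L` into the row `X`. -/
def finalRow : List ℕ → List (ℕ × ℕ) → List ℕ
  | X, [] => X
  | X, p :: L => finalRow (rowInsert p.2 X).1 L

/-- The values bumped out of the row `X` while inserting `L`, labelled by the columns at which
the bumps happen. -/
def bumps : List ℕ → List (ℕ × ℕ) → List (ℕ × ℕ)
  | _, [] => []
  | X, p :: L =>
    ((rowInsert p.2 X).2.map fun y => (p.1, y)).toList ++ bumps (rowInsert p.2 X).1 L

/-- The columns of `L` whose insertion into the row `X` does not bump anything. -/
def stays : List ℕ → List (ℕ × ℕ) → List ℕ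
  | _, [] => []
  | X, p :: L =>
    (if (rowInsert p.2 X).2 = none then [p.1] else []) ++ stays (rowInsert p.2 X).1 L

/-- Shift the chain with values `rs` one step to the left inside `L`: every value of the chain is
replaced by the next one, and the last one is removed. -/
def shift : List ℕ → List (ℕ × ℕ) → List (ℕ × ℕ)
  | [], L => L
  | _ :: _, [] => []
  | r :: rs, p :: L =>
    if p.2 = r then (rs.head?.map fun s => (p.1, s)).toList ++ shift rs L
    else p :: shift (r :: rs) L

theorem shift_cons_of_ne {r : ℕ} {rs : List ℕ} {p : ℕ × ℕ} {L : List (ℕ × ℕ)} (h : p.2 ≠ r) :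
    shift (r :: rs) (p :: L) = p :: shift (r :: rs) L := by
  simp [shift, h]

theorem shift_cons_cons_self {c r s : ℕ} {rs : List ℕ} {L : List (ℕ × ℕ)} :
    shift (r :: s :: rs) ((c, r) :: L) = (c, s) :: shift (s :: rs) L := by
  simp [shift]

theorem shift_singleton_self {c r : ℕ} {L : List (ℕ × ℕ)} :
    shift [r] ((c, r) :: L) = L := by
  simp [shift]

theorem bumps_cons_none {X X' : List ℕ} {p : ℕ × ℕ} {L : List (ℕ × ℕ)}
    (h : rowInsert p.2 X = (X', none)) : bumps X (p :: L) = bumps X' L := by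
  simp [bumps, h]

theorem bumps_cons_some {X X' : List ℕ} {y : ℕ} {p : ℕ × ℕ} {L : List (ℕ × ℕ)}
    (h : rowInsert p.2 X = (X', some y)) : bumps X (p :: L) = (p.1, y) :: bumps X' L := by
  simp [bumps, h]

section RowInsert

theorem rowInsert_cases (v : ℕ) (X : List ℕ) :
    ((∀ x ∈ X, x ≤ v) ∧ rowInsert v X = (X ++ [v], none)) ∨
      ∃ A y C, X = A ++ y :: C ∧ (∀ x ∈ A, x ≤ v) ∧ v < y ∧
        rowInsert v X = (A ++ v :: C, some y) := by
  induction X with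
  | nil => left; simp [rowInsert]
  | cons x xs ih =>
    by_cases hx : v < x
    · right
      exact ⟨[], x, xs, by simp, by simp, hx, by simp [rowInsert, hx]⟩
    · rcases ih with ⟨h1, h2⟩ | ⟨A, y, C, h1, h2, h3, h4⟩
      · left
        refine ⟨?_, by simp [rowInsert, hx, h2]⟩
        intro z hz
        rcases List.mem_cons.1 hz with rfl | hz
        · omega
        · exact h1 z hz
      · right
        refine ⟨x :: A, y, C, by simp [h1], ?_, h3, by simp [rowInsert, hx, h4]⟩
        intro z hz
        rcases List.mem_cons.1 hz with rfl | hz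
        · omega
        · exact h2 z hz

theorem rowInsert_append_of_le {v : ℕ} {A : List ℕ} (C : List ℕ) (h : ∀ x ∈ A, x ≤ v) :
    rowInsert v (A ++ C) = (A ++ (rowInsert v C).1, (rowInsert v C).2) := by
  induction A with
  | nil => simp
  | cons x xs ih =>
    have hx : ¬ v < x := by have := h x (by simp); omega
    simp [rowInsert, hx, ih (fun z hz => h z (by simp [hz]))]

theorem rowInsert_of_le {v : ℕ} {A : List ℕ} (h : ∀ x ∈ A, x ≤ v) :
    rowInsert v A = (A ++ [v], none) := by
  simpa [rowInsert] using rowInsert_append_of_le [] h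

theorem rowInsert_bump {v y : ℕ} {A : List ℕ} (C : List ℕ) (h : ∀ x ∈ A, x ≤ v) (hy : v < y) :
    rowInsert v (A ++ y :: C) = (A ++ v :: C, some y) := by
  simp [rowInsert_append_of_le _ h, rowInsert, hy]

theorem rowInsert_perm (v : ℕ) (X : List ℕ) :
    List.Perm ((rowInsert v X).2.toList ++ (rowInsert v X).1) (v :: X) := by
  rcases rowInsert_cases v X with ⟨-, h⟩ | ⟨A, y, C, rfl, -, -, h⟩
  · simp [h]
  · rw [h]
    simp only [Option.toList_some, List.singleton_append]
    calc (y :: (A ++ v :: C)).Perm (y :: v :: (A ++ C)) := List.perm_middle.cons y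
      _ |>.Perm (v :: y :: (A ++ C)) := List.Perm.swap ..
      _ |>.Perm (v :: (A ++ y :: C)) := List.perm_middle.symm.cons v

theorem rowInsert_mem {v z : ℕ} {X : List ℕ} (h : z ∈ (rowInsert v X).1) : z = v ∨ z ∈ X := by
  have := (rowInsert_perm v X).mem_iff.1 (List.mem_append_right _ h)
  simpa using this

theorem rowInsert_sorted {v : ℕ} {X : List ℕ} (hX : X.Pairwise (· < ·)) (hv : v ∉ X) :
    (rowInsert v X).1.Pairwise (· < ·) := by
  rcases rowInsert_cases v X with ⟨h1, h⟩ | ⟨A, y, C, rfl, h1, h2, h⟩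
  · rw [h]
    simp only [List.pairwise_append, List.pairwise_singleton, List.mem_singleton]
    refine ⟨hX, trivial, ?_⟩
    rintro z hz _ rfl
    exact lt_of_le_of_ne (h1 z hz) (fun e => hv (e ▸ hz))
  · rw [h]
    simp only [List.pairwise_append, List.pairwise_cons, List.mem_cons, List.mem_append] at *
    obtain ⟨hA, ⟨hyC, hC⟩, hAC⟩ := hX
    refine ⟨hA, ⟨fun z hz => h2.trans (hyC z hz), hC⟩, ?_⟩
    rintro z hz _ (rfl | hw)
    · exact lt_of_le_of_ne (h1 z hz) (fun e => hv (Or.inl (e ▸ hz)))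
    · exact hAC z hz _ (Or.inr hw)

theorem rowInsert_some {v y : ℕ} {X Y : List ℕ} (h : rowInsert v X = (Y, some y)) :
    ∃ A C, X = A ++ y :: C ∧ Y = A ++ v :: C ∧ (∀ x ∈ A, x ≤ v) ∧ v < y := by
  rcases rowInsert_cases v X with ⟨-, h'⟩ | ⟨A, y', C, rfl, h1, h2, h'⟩
  · simp [h'] at h
  · rw [h'] at h
    obtain ⟨rfl, h⟩ := Prod.mk.inj h
    cases h
    exact ⟨A, C, rfl, rfl, h1, h2⟩

theorem rowInsert_gap {v y z : ℕ} {X Y : List ℕ} (hX : X.Pairwise (· < ·))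
    (h : rowInsert v X = (Y, some y)) (hz : z ∈ X) : z ≤ v ∨ y ≤ z := by
  obtain ⟨A, C, rfl, rfl, h1, h2⟩ := rowInsert_some h
  simp only [List.pairwise_append, List.pairwise_cons, List.mem_append, List.mem_cons] at *
  rcases hz with hz | rfl | hz
  · exact Or.inl (h1 z hz)
  · exact Or.inr le_rfl
  · exact Or.inr (hX.2.1.1 z hz).le

theorem rowInsert_comm_of_ge {f g x : ℕ} {X Y : List ℕ} (h : rowInsert f X = (Y, some g))
    (hx : g ≤ x) : (rowInsert x X).2 = (rowInsert x Y).2 ∧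
      rowInsert f (rowInsert x X).1 = ((rowInsert x Y).1, some g) := by
  obtain ⟨A, C, rfl, rfl, h1, h2⟩ := rowInsert_some h
  have hA : ∀ z ∈ A, z ≤ x := fun z hz => by have := h1 z hz; omega
  have e1 : ¬ x < g := by omega
  have e2 : ¬ x < f := by omega
  simp only [rowInsert_append_of_le _ hA, rowInsert, e1, e2, if_false, true_and]
  exact rowInsert_bump _ h1 h2

theorem rowInsert_append_of_exists {v : ℕ} {A : List ℕ} (C : List ℕ) (h : ∃ x ∈ A, v < x) :
    rowInsert v (A ++ C) = ((rowInsert v A).1 ++ C, (rowInsert v A).2) := by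
  rcases rowInsert_cases v A with ⟨h1, -⟩ | ⟨A', y, C', rfl, h1, h2, h3⟩
  · obtain ⟨x, hx, hv⟩ := h
    have := h1 x hx
    omega
  · rw [h3, List.append_assoc, List.cons_append, rowInsert_bump _ h1 h2]
    simp

theorem rowInsert_comm_of_lt {f g x : ℕ} {X Y : List ℕ} (hX : X.Pairwise (· < ·))
    (h : rowInsert f X = (Y, some g)) (hx : x < f) :
    ((rowInsert x X).2 = (rowInsert x Y).2 ∧
      rowInsert f (rowInsert x X).1 = ((rowInsert x Y).1, some g)) ∨
    ((rowInsert x X).2 = some g ∧ (rowInsert x Y).2 = some f ∧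
      (rowInsert x X).1 = (rowInsert x Y).1 ∧ ∀ z ∈ (rowInsert x X).1, z ≤ x ∨ f < z) := by
  obtain ⟨A, C, rfl, rfl, h1, h2⟩ := rowInsert_some h
  by_cases hA : ∃ z ∈ A, x < z
  · left
    rw [rowInsert_append_of_exists _ hA, rowInsert_append_of_exists _ hA]
    refine ⟨rfl, rowInsert_bump _ ?_ h2⟩
    intro z hz
    rcases rowInsert_mem hz with rfl | hz
    · exact hx.le
    · exact h1 z hz
  · right
    push Not at hA
    rw [rowInsert_bump _ hA (hx.trans h2), rowInsert_bump _ hA hx]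
    refine ⟨rfl, rfl, rfl, ?_⟩
    simp only [List.pairwise_append, List.pairwise_cons, List.mem_append, List.mem_cons] at *
    rintro z (hz | rfl | hz)
    · exact Or.inl (hA z hz)
    · exact Or.inl le_rfl
    · exact Or.inr (h2.trans (hX.2.1.1 z hz))

theorem rowInsert_of_gap {f r : ℕ} {X : List ℕ} (hr : r < f) (h : ∀ z ∈ X, z < r ∨ f < z) :
    (rowInsert f X).2 = (rowInsert r X).2 ∧
      rowInsert r (rowInsert f X).1 = ((rowInsert r X).1, some f) := by
  rcases rowInsert_cases f X with ⟨h1, h2⟩ | ⟨A, y, C, rfl, h1, h2, h3⟩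
  · have hX : ∀ z ∈ X, z ≤ r := fun z hz => by have := h1 z hz; have := h z hz; omega
    rw [h2, rowInsert_of_le hX]
    exact ⟨rfl, rowInsert_bump _ hX hr⟩
  · have hA : ∀ z ∈ A, z ≤ r := fun z hz => by
      have := h1 z hz; have := h z (by simp [hz]); omega
    rw [h3, rowInsert_bump _ hA (hr.trans h2)]
    exact ⟨rfl, rowInsert_bump _ hA hr⟩

theorem rowInsert_bumps_of_mem {f r : ℕ} {X : List ℕ} (hX : X.Pairwise (· < ·)) (hf : f ∈ X)
    (hr : r < f) : ∃ Y g, rowInsert r X = (Y, some g) ∧ g ≤ f := by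
  rcases rowInsert_cases r X with ⟨h1, -⟩ | ⟨A, y, C, e, h1, h2, h3⟩
  · have := h1 f hf; omega
  · refine ⟨_, _, h3, ?_⟩
    rcases rowInsert_gap hX h3 hf with h | h
    · omega
    · exact h

end RowInsert

theorem perm_finalRow (X : List ℕ) (L : List (ℕ × ℕ)) :
    List.Perm ((bumps X L).map Prod.snd ++ finalRow X L) (X ++ L.map Prod.snd) := by
  induction L generalizing X with
  | nil => simp [bumps, finalRow]
  | cons p L ih =>
    have h1 := ih (rowInsert p.2 X).1
    have h2 := rowInsert_perm p.2 X
    have e : ((bumps X (p :: L)).map Prod.snd ++ finalRow X (p :: L)) =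
        (rowInsert p.2 X).2.toList ++ ((bumps (rowInsert p.2 X).1 L).map Prod.snd ++
          finalRow (rowInsert p.2 X).1 L) := by
      cases h : (rowInsert p.2 X).2 <;> simp [bumps, finalRow, h]
    rw [e]
    refine (h1.append_left _).trans ?_
    rw [← List.append_assoc]
    refine (h2.append_right _).trans ?_
    simpa using List.perm_middle.symm

theorem nodup_step {X : List ℕ} {p : ℕ × ℕ} {L : List (ℕ × ℕ)}
    (h : (X ++ (p :: L).map Prod.snd).Nodup) :
    ((rowInsert p.2 X).1 ++ L.map Prod.snd).Nodup ∧
      ∀ y, (rowInsert p.2 X).2 = some y → y ∉ (rowInsert p.2 X).1 ++ L.map Prod.snd := by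
  have h1 : ((rowInsert p.2 X).2.toList ++ ((rowInsert p.2 X).1 ++ L.map Prod.snd)).Perm
      (X ++ (p :: L).map Prod.snd) := by
    rw [← List.append_assoc]
    refine ((rowInsert_perm p.2 X).append_right _).trans ?_
    simpa using List.perm_middle.symm
  have h2 := h1.nodup_iff.2 h
  refine ⟨(List.nodup_append.1 h2).2.1, ?_⟩
  intro y hy hmem
  exact (List.nodup_append.1 h2).2.2 y (by simp [hy]) y hmem rfl

theorem exists_chain_of_bumps {X : List ℕ} {L : List (ℕ × ℕ)} (hX : X.Pairwise (· < ·))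
    (hn : (X ++ L.map Prod.snd).Nodup) {y : ℕ} {ys : List ℕ}
    (hs : (y :: ys).Sublist ((bumps X L).map Prod.snd)) (hd : (y :: ys).Pairwise (· > ·)) :
    ∃ es : List ℕ, es.Sublist (L.map Prod.snd) ∧ es.Pairwise (· > ·) ∧
      es.length = ys.length + 1 ∧ (∀ e ∈ es, e < y) ∧
      (y ∈ X ∨ (y :: es).Sublist (L.map Prod.snd)) := by
  induction L generalizing X y ys with
  | nil => simp [bumps] at hs
  | cons p L ih =>
    have hp : p.2 ∉ X := by
      simp only [List.map_cons, List.nodup_append, List.mem_cons] at hn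
      intro h
      exact hn.2.2 _ h _ (Or.inl rfl) rfl
    have hX1 := rowInsert_sorted hX hp
    have hn1 := (nodup_step hn).1
    have skip : (y :: ys).Sublist ((bumps (rowInsert p.2 X).1 L).map Prod.snd) →
        ∃ es : List ℕ, es.Sublist ((p :: L).map Prod.snd) ∧ es.Pairwise (· > ·) ∧
        es.length = ys.length + 1 ∧ (∀ e ∈ es, e < y) ∧
        (y ∈ X ∨ (y :: es).Sublist ((p :: L).map Prod.snd)) := by
      intro hs'
      obtain ⟨es, h1, h2, h3, h4, h5⟩ := ih hX1 hn1 hs' hd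
      refine ⟨es, h1.cons _, h2, h3, h4, ?_⟩
      rcases h5 with h5 | h5
      · rcases rowInsert_mem h5 with rfl | h5
        · exact Or.inr (by simpa using h1)
        · exact Or.inl h5
      · exact Or.inr (h5.cons _)
    rcases rowInsert_cases p.2 X with ⟨-, h⟩ | ⟨A, z, C, hXe, hA, hz, h⟩
    · rw [bumps_cons_none h] at hs
      exact skip (by rw [h]; exact hs)
    · have hb := bumps_cons_some (L := L) h
      rw [hb, List.map_cons, List.sublist_cons_iff] at hs
      rcases hs with hs | ⟨r, hr, hs⟩
      · exact skip (by rw [h]; exact hs)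
      · obtain ⟨rfl, rfl⟩ := List.cons.inj hr
        have hyX : y ∈ X := by rw [hXe]; simp
        cases ys with
        | nil => exact ⟨[p.2], by simp, by simp, by simp, by simpa using hz, Or.inl hyX⟩
        | cons y2 ys =>
          have hy2 : y2 < y := (List.pairwise_cons.1 hd).1 y2 (by simp)
          have hs' : (y2 :: ys).Sublist ((bumps (rowInsert p.2 X).1 L).map Prod.snd) := by
            rw [h]; exact hs
          obtain ⟨es, h1, h2, h3, h4, h5⟩ := ih hX1 hn1 hs' (List.pairwise_cons.1 hd).2
          rcases h5 with h5 | h5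
          · have hle : y2 ≤ p.2 := by
              rcases rowInsert_mem h5 with rfl | h5
              · exact le_rfl
              · rcases rowInsert_gap hX h h5 with h' | h'
                · exact h'
                · omega
            refine ⟨p.2 :: es, by simpa using h1, ?_, by simp [h3], ?_, Or.inl hyX⟩
            · exact List.pairwise_cons.2 ⟨fun e he => (h4 e he).trans_le hle, h2⟩
            · intro e he
              rcases List.mem_cons.1 he with rfl | he
              · exact hz
              · exact (h4 e he).trans hy2
          · refine ⟨y2 :: es, h5.cons _, List.pairwise_cons.2 ⟨h4, h2⟩, by simp [h3], ?_, Or.inl hyX⟩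
            intro e he
            rcases List.mem_cons.1 he with rfl | he
            · exact hy2
            · exact (h4 e he).trans hy2

theorem LexLE.head_le {x y : ℕ} {xs ys : List ℕ} (h : LexLE (x :: xs) (y :: ys)) : x ≤ y := by
  simp only [LexLE] at h
  omega

theorem LexLE.tail {x : ℕ} {xs ys : List ℕ} (h : LexLE (x :: xs) (x :: ys)) : LexLE xs ys := by
  simpa [LexLE] using h

namespace IsLead

variable {B r x : ℕ} {rs w : List ℕ}

theorem miss (h : IsLead B (r :: rs) (x :: w)) (hx : x ≠ r) : IsLead B (r :: rs) w where
  sub := by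
    rcases List.sublist_cons_iff.1 h.sub with h1 | ⟨l, h1, -⟩
    · exact h1
    · exact absurd (List.cons.inj h1).1.symm hx
  dec := h.dec
  bdd := h.bdd
  min ts h1 := h.min ts (h1.cons _)
  short ts h1 := h.short ts (h1.cons _)

theorem head_le {ts : List ℕ} {t : ℕ} (h : IsLead B (r :: rs) w) (h1 : (t :: ts).Sublist w)
    (h2 : (t :: ts).Pairwise (· > ·)) (h3 : t < B) (h4 : ts.length = rs.length) : r ≤ t := by
  refine (h.min (t :: ts) h1 h2 ?_ (by simp [h4])).head_le
  intro z hz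
  rcases List.mem_cons.1 hz with rfl | hz
  · exact h3
  · exact lt_trans ((List.pairwise_cons.1 h2).1 z hz) h3

theorem hit (h : IsLead B (r :: rs) (r :: w)) : IsLead r rs w where
  sub := List.cons_sublist_cons.1 h.sub
  dec := (List.pairwise_cons.1 h.dec).2
  bdd := (List.pairwise_cons.1 h.dec).1
  min ts h1 h2 h3 h4 := by
    have hr := h.bdd r (by simp)
    refine (h.min (r :: ts) (h1.cons_cons _) (List.pairwise_cons.2 ⟨h3, h2⟩) ?_ (by simp [h4])).tail
    intro z hz
    rcases List.mem_cons.1 hz with rfl | hz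
    · exact hr
    · exact (h3 z hz).trans hr
  short ts h1 h2 h3 h4 := by
    have hr := h.bdd r (by simp)
    cases ts with
    | nil => simp at h4
    | cons t ts =>
      have ht := h3 t (by simp)
      have := h.head_le (h1.cons _) h2 (ht.trans hr) (by simpa using h4)
      omega

end IsLead

/-- Inserting `L` into `X` and `L'` into `Y` produces the same row, and the bumped words differ by
shifting the chain `g :: τ`, which is the lexicographically smallest decreasing subsequence of its
length and ends at the last bump, in column `a`. -/
structure Tracks (a g : ℕ) (X Y : List ℕ) (L L' : List (ℕ × ℕ)) (τ : List ℕ) : Prop where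
  dec : (g :: τ).Pairwise (· > ·)
  sub : (g :: τ).Sublist ((bumps X L).map Prod.snd)
  bumps_eq : bumps Y L' = shift (g :: τ) (bumps X L)
  min : ∀ ys : List ℕ, ys.Sublist ((bumps X L).map Prod.snd) → ys.Pairwise (· > ·) →
    ys.length = τ.length + 1 → LexLE (g :: τ) ys
  final : finalRow X L = finalRow Y L'
  last : ∃ w, (bumps X L).getLast? = some (a, w) ∧ (g :: τ).getLast? = some w

namespace Tracks

variable {a g : ℕ} {X Y X₁ Y₁ τ : List ℕ} {L L' : List (ℕ × ℕ)}

theorem cons_same {c u v : ℕ} {o : Option ℕ} (h : Tracks a g X₁ Y₁ L L' τ)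
    (hX : rowInsert u X = (X₁, o)) (hY : rowInsert v Y = (Y₁, o)) (ho : o ≠ some g)
    (hb : ∀ y ys, (y :: ys).Sublist ((bumps X ((c, u) :: L)).map Prod.snd) →
      (y :: ys).Pairwise (· > ·) → ys.length = τ.length → g ≤ y) :
    Tracks a g X Y ((c, u) :: L) ((c, v) :: L') τ := by
  have hmin : ∀ ys : List ℕ, ys.Sublist ((bumps X ((c, u) :: L)).map Prod.snd) →
      ys.Pairwise (· > ·) → ys.length = τ.length + 1 → LexLE (g :: τ) ys := by
    intro ys h1 h2 h3
    cases ys with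
    | nil => simp at h3
    | cons y ys =>
      rcases (hb y ys h1 h2 (by simpa using h3)).lt_or_eq with h4 | rfl
      · exact Or.inl h4
      · refine h.min _ ?_ h2 h3
        cases o with
        | none => rwa [bumps_cons_none (p := (c, u)) hX] at h1
        | some z =>
          rw [bumps_cons_some (p := (c, u)) hX, List.map_cons, List.sublist_cons_iff] at h1
          rcases h1 with h1 | ⟨l, h1, -⟩
          · exact h1
          · exact absurd (congrArg some (List.cons.inj h1).1.symm) ho
  have hfin : finalRow X ((c, u) :: L) = finalRow Y ((c, v) :: L') := by
    simpa [finalRow, hX, hY] using h.final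
  cases o with
  | none =>
    refine ⟨h.dec, ?_, ?_, hmin, hfin, ?_⟩
    · simpa [bumps_cons_none (p := (c, u)) hX] using h.sub
    · simpa [bumps_cons_none (p := (c, u)) hX, bumps_cons_none (p := (c, v)) hY] using h.bumps_eq
    · simpa [bumps_cons_none (p := (c, u)) hX] using h.last
  | some z =>
    have hz : z ≠ g := fun e => ho (by rw [e])
    refine ⟨h.dec, ?_, ?_, hmin, hfin, ?_⟩
    · rw [bumps_cons_some (p := (c, u)) hX]
      exact h.sub.cons _
    · rw [bumps_cons_some (p := (c, u)) hX, bumps_cons_some (p := (c, v)) hY, h.bumps_eq, shift_cons_of_ne hz]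
    · obtain ⟨w, h1, h2⟩ := h.last
      exact ⟨w, by rw [bumps_cons_some (p := (c, u)) hX]; simp [List.getLast?_cons, h1], h2⟩

theorem cons_hit {g' c u v : ℕ} (h : Tracks a g' X₁ Y₁ L L' τ)
    (hX : rowInsert u X = (X₁, some g)) (hY : rowInsert v Y = (Y₁, some g')) (hg : g' < g)
    (hb : ∀ y ys, (y :: ys).Sublist ((bumps X ((c, u) :: L)).map Prod.snd) →
      (y :: ys).Pairwise (· > ·) → ys.length = τ.length + 1 → g ≤ y) :
    Tracks a g X Y ((c, u) :: L) ((c, v) :: L') (g' :: τ) := by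
  have hX' := bumps_cons_some (p := (c, u)) (L := L) hX
  have hY' := bumps_cons_some (p := (c, v)) (L := L') hY
  refine ⟨?_, ?_, ?_, ?_, ?_, ?_⟩
  · have h1 := h.dec
    refine List.pairwise_cons.2 ⟨?_, h1⟩
    intro z hz
    rcases List.mem_cons.1 hz with rfl | hz
    · exact hg
    · exact lt_trans ((List.pairwise_cons.1 h1).1 z hz) hg
  · rw [hX']
    exact h.sub.cons_cons _
  · rw [hX', hY', h.bumps_eq, shift_cons_cons_self]
  · intro ys h1 h2 h3
    cases ys with
    | nil => simp at h3
    | cons y ys =>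
      rcases (hb y ys h1 h2 (by simpa using h3)).lt_or_eq with h4 | rfl
      · exact Or.inl h4
      · refine Or.inr ⟨rfl, h.min _ ?_ (List.pairwise_cons.1 h2).2 (by simpa using h3)⟩
        rw [hX', List.map_cons] at h1
        exact List.cons_sublist_cons.1 h1
  · simpa [finalRow, hX, hY] using h.final
  · obtain ⟨w, h1, h2⟩ := h.last
    exact ⟨w, by rw [hX']; simp [List.getLast?_cons, h1], by
      rw [List.getLast?_cons, h2]; rfl⟩

end Tracks

theorem le_head_of_bumped {B f g : ℕ} {X Y rs : List ℕ} {L : List (ℕ × ℕ)}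
    (hX : X.Pairwise (· < ·)) (hn : (X ++ L.map Prod.snd).Nodup)
    (hL : IsLead B (f :: rs) (L.map Prod.snd)) (hf : rowInsert f X = (Y, some g)) (hg : g ≤ B)
    {y : ℕ} {ys : List ℕ} (h1 : (y :: ys).Sublist ((bumps X L).map Prod.snd))
    (h2 : (y :: ys).Pairwise (· > ·)) (h3 : ys.length = rs.length) : g ≤ y := by
  by_contra! hy
  obtain ⟨es, e1, e2, e3, e4, e5⟩ := exists_chain_of_bumps hX hn h1 h2
  have hyf : f < y := by
    by_contra! hyf
    cases es with
    | nil => simp at e3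
    | cons e es =>
      have := e4 e (by simp)
      have := hL.head_le e1 e2 (by omega) (by simpa [h3] using e3)
      omega
  rcases e5 with e5 | e5
  · rcases rowInsert_gap hX hf e5 with h | h <;> omega
  · refine hL.short (y :: es) e5 (List.pairwise_cons.2 ⟨e4, e2⟩) ?_ (by simp [e3, h3])
    intro z hz
    rcases List.mem_cons.1 hz with rfl | hz
    · omega
    · have := e4 z hz
      omega

theorem le_head_of_equal {B f r : ℕ} {X rs : List ℕ} {L : List (ℕ × ℕ)}
    (hX : X.Pairwise (· < ·)) (hn : (X ++ L.map Prod.snd).Nodup)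
    (hL : IsLead B (f :: r :: rs) (L.map Prod.snd))
    (hI : ∀ z ∈ X, z < f → ∀ es : List ℕ, es.Sublist (L.map Prod.snd) → es.Pairwise (· > ·) →
      es.length = rs.length + 1 → ¬ ∀ e ∈ es, e < z)
    {y : ℕ} {ys : List ℕ} (h1 : (y :: ys).Sublist ((bumps X L).map Prod.snd))
    (h2 : (y :: ys).Pairwise (· > ·)) (h3 : ys.length = rs.length) : f ≤ y := by
  by_contra! hy
  obtain ⟨es, e1, e2, e3, e4, e5⟩ := exists_chain_of_bumps hX hn h1 h2
  rcases e5 with e5 | e5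
  · exact hI y e5 hy es e1 e2 (by omega) e4
  · have := hL.bdd f (by simp)
    have := hL.head_le e5 (List.pairwise_cons.2 ⟨e4, e2⟩) (by omega) (by simp [e3, h3])
    omega

theorem getLast?_of_cons {α : Type*} {p q : α} {L : List α} (h : (p :: L).getLast? = some q)
    (hL : L ≠ []) : L.getLast? = some q := by
  rwa [List.getLast?_cons_of_ne_nil hL] at h

theorem exists_tracks (L : List (ℕ × ℕ)) :
    (∀ (X Y rs : List ℕ) (f g B a v : ℕ), X.Pairwise (· < ·) →
      (X ++ L.map Prod.snd).Nodup → IsLead B (f :: rs) (L.map Prod.snd) →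
      L.getLast? = some (a, v) → (f :: rs).getLast? = some v →
      rowInsert f X = (Y, some g) → g ≤ B →
      ∃ τ, τ.length = rs.length ∧ Tracks a g X Y L (shift (f :: rs) L) τ) ∧
    (∀ (X rs : List ℕ) (f r B a v : ℕ), X.Pairwise (· < ·) →
      (X ++ L.map Prod.snd).Nodup → IsLead B (f :: r :: rs) (L.map Prod.snd) →
      L.getLast? = some (a, v) → (f :: r :: rs).getLast? = some v →
      (∀ z ∈ X, z < r ∨ f < z) →
      (∀ z ∈ X, z < f → ∀ es : List ℕ, es.Sublist (L.map Prod.snd) → es.Pairwise (· > ·) →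
        es.length = rs.length + 1 → ¬ ∀ e ∈ es, e < z) →
      ∃ τ, τ.length = rs.length ∧ Tracks a f X X L (shift (f :: r :: rs) L) τ) := by
  induction L with
  | nil => constructor <;> simp
  | cons p L ih =>
    obtain ⟨ihA, ihB⟩ := ih
    obtain ⟨c, x⟩ := p
    have next : ∀ {B r : ℕ} {rs : List ℕ} {q : ℕ × ℕ}, IsLead B (r :: rs) (L.map Prod.snd) →
        ((c, x) :: L).getLast? = some q → L.getLast? = some q := by
      intro B r rs q h1 h2
      refine getLast?_of_cons h2 ?_
      rintro rfl
      simpa using h1.sub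
    constructor
    · intro X Y rs f g B a v hX hn hL hl hv hf hg
      have hb : ∀ {y ys}, _ → _ → _ → _ := fun {y ys} => @le_head_of_bumped B f g X Y rs _
        hX hn hL hf hg y ys
      have hxX : x ∉ X := by
        simp only [List.map_cons, List.nodup_append, List.mem_cons] at hn
        intro h
        exact hn.2.2 _ h _ (Or.inl rfl) rfl
      have hX1 := rowInsert_sorted hX hxX
      obtain ⟨hn1, hn2⟩ := nodup_step hn
      have hfg : f < g := (rowInsert_some hf).choose_spec.choose_spec.2.2.2
      rw [List.map_cons] at hL
      rcases eq_or_ne x f with rfl | hxf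
      · have hL' := hL.hit
        cases rs with
        | nil =>
          have hv' : x = v := by simpa using hv
          have hLn : L = [] := by
            by_contra hne
            have h1 := List.mem_of_getLast? (getLast?_of_cons hl hne)
            have h2 : v ∈ L.map Prod.snd := List.mem_map.2 ⟨_, h1, rfl⟩
            rw [← hv'] at h2
            have := (List.nodup_append.1 hn).2.1
            simp only [List.map_cons, List.nodup_cons] at this
            exact this.1 h2
          subst hLn
          have hca : c = a := by simpa using congrArg (Option.map Prod.fst) hl
          subst hca
          refine ⟨[], rfl, ?_⟩
          have hbX : bumps X [(c, x)] = [(c, g)] := by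
            rw [bumps_cons_some (p := (c, x)) hf]; simp [bumps]
          refine ⟨by simp, by simp [hbX], by
            rw [hbX]; simp [shift_singleton_self, bumps], ?_,
            by simp [finalRow, shift_singleton_self, hf], ⟨g, by simp [hbX], by simp⟩⟩
          intro ys h1 h2 h3
          rw [hbX] at h1
          rcases List.sublist_singleton.1 h1 with rfl | rfl
          · simp at h3
          · simp [LexLE]
        | cons r rs =>
          have hrx : r < x := hL'.bdd r (by simp)
          rw [hf] at hX1 hn1
          have hxY : x ∈ Y := by
            obtain ⟨A, C, -, rfl, -⟩ := rowInsert_some hf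
            simp
          obtain ⟨Y', g', h1, h2⟩ := rowInsert_bumps_of_mem hX1 hxY hrx
          obtain ⟨τ, t1, t2⟩ := ihA Y Y' rs r g' x a v hX1 hn1 hL' (next hL' hl)
            (by rwa [List.getLast?_cons_of_ne_nil (by simp)] at hv) h1 h2
          refine ⟨g' :: τ, by simp [t1], ?_⟩
          rw [shift_cons_cons_self]
          exact t2.cons_hit hf h1 (by omega) (fun y ys k1 k2 k3 => hb k1 k2 (by simp [k3, t1]))
      · have hL' := hL.miss hxf
        have same : (rowInsert x X).2 = (rowInsert x Y).2 →
            rowInsert f (rowInsert x X).1 = ((rowInsert x Y).1, some g) →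
            ∃ τ, τ.length = rs.length ∧
              Tracks a g X Y ((c, x) :: L) (shift (f :: rs) ((c, x) :: L)) τ := by
          intro h1 h2
          obtain ⟨τ, t1, t2⟩ := ihA _ _ rs f g B a v hX1 hn1 hL' (next hL' hl) hv h2 hg
          refine ⟨τ, t1, ?_⟩
          rw [shift_cons_of_ne (p := (c, x)) hxf]
          refine t2.cons_same (o := (rowInsert x X).2) rfl (by rw [h1]) ?_
            (fun y ys k1 k2 k3 => hb k1 k2 (k3.trans t1))
          intro hg'
          refine hn2 g hg' (List.mem_append_left _ ?_)
          obtain ⟨A, C, e, -⟩ := rowInsert_some h2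
          rw [e]; simp
        rcases lt_or_gt_of_ne hxf with hlt | hgt
        · rcases rowInsert_comm_of_lt hX hf hlt with ⟨h1, h2⟩ | ⟨h1, h2, h3, h4⟩
          · exact same h1 h2
          · have hfB := hL.bdd f (by simp)
            cases rs with
            | nil =>
              have := hL.head_le (t := x) (ts := []) (by simp) (by simp) (by omega) rfl
              omega
            | cons r rs =>
              have hxr : x < r := by
                by_contra! hrx
                have hne : r ≠ x := by
                  rintro rfl
                  have h5 := (List.nodup_append.1 hn).2.1
                  simp only [List.map_cons, List.nodup_cons] at h5
                  exact h5.1 (hL'.sub.subset (by simp))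
                have h5 := List.pairwise_cons.1 hL.dec
                have h6 := List.pairwise_cons.1 h5.2
                have := hL.head_le (t := x) (ts := r :: rs)
                  (((List.sublist_cons_self _ _).trans hL'.sub).cons_cons _)
                  (List.pairwise_cons.2 ⟨?_, h5.2⟩) (by omega) rfl
                · omega
                · intro z hz
                  rcases List.mem_cons.1 hz with rfl | hz
                  · omega
                  · have := h6.1 z hz
                    omega
              obtain ⟨τ, t1, t2⟩ := ihB (rowInsert x X).1 rs f r B a v hX1 hn1 hL' (next hL' hl)
                hv (fun z hz => (h4 z hz).imp_left (fun h => by omega)) (by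
                  intro z hz hzf es e1 e2 e3 e4
                  have hzx : z ≤ x := by rcases h4 z hz with h | h <;> omega
                  have := hL.head_le (t := x) (ts := es) (e1.cons_cons _)
                    (List.pairwise_cons.2 ⟨fun e he => (e4 e he).trans_le hzx, e2⟩)
                    (by omega) (by simpa using e3)
                  omega)
              refine ⟨f :: τ, by simp [t1], ?_⟩
              rw [shift_cons_of_ne (p := (c, x)) hxf]
              exact t2.cons_hit (Prod.ext rfl h1) (Prod.ext h3.symm h2) hfg
                (fun y ys k1 k2 k3 => hb k1 k2 (by simp [k3, t1]))
        · have hBx : B ≤ x := by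
            by_contra! hxB
            have h5 := List.pairwise_cons.1 hL.dec
            refine hL.short (x :: f :: rs) (hL'.sub.cons_cons _)
              (List.pairwise_cons.2 ⟨?_, hL.dec⟩) ?_ rfl
            · intro z hz
              rcases List.mem_cons.1 hz with rfl | hz
              · exact hgt
              · exact lt_trans (h5.1 z hz) hgt
            · intro z hz
              rcases List.mem_cons.1 hz with rfl | hz
              · exact hxB
              · exact hL.bdd z hz
          obtain ⟨h1, h2⟩ := rowInsert_comm_of_ge hf (hg.trans hBx)
          exact same h1 h2
    · intro X rs f r B a v hX hn hL hl hv hgap hI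
      have hb : ∀ {y ys}, _ → _ → _ → _ := fun {y ys} => @le_head_of_equal B f r X rs _
        hX hn hL hI y ys
      have hxX : x ∉ X := by
        simp only [List.map_cons, List.nodup_append, List.mem_cons] at hn
        intro h
        exact hn.2.2 _ h _ (Or.inl rfl) rfl
      have hX1 := rowInsert_sorted hX hxX
      obtain ⟨hn1, hn2⟩ := nodup_step hn
      have hdec := hL.dec
      have hd1 := List.pairwise_cons.1 hdec
      have hrf : r < f := hd1.1 r (by simp)
      have hfB := hL.bdd f (by simp)
      rw [List.map_cons] at hL
      rcases eq_or_ne x f with rfl | hxf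
      · have hL' := hL.hit
        obtain ⟨h1, h2⟩ := rowInsert_of_gap hrf hgap
        obtain ⟨τ, t1, t2⟩ := ihA _ _ rs r x x a v hX1 hn1 hL' (next hL' hl)
          (by rwa [List.getLast?_cons_of_ne_nil (by simp)] at hv) h2 le_rfl
        refine ⟨τ, t1, ?_⟩
        rw [shift_cons_cons_self]
        refine t2.cons_same (o := (rowInsert x X).2) rfl (by rw [h1]) ?_
          (fun y ys k1 k2 k3 => hb k1 k2 (k3.trans t1))
        intro hx
        obtain ⟨A, C, e, -⟩ := rowInsert_some (Prod.ext rfl hx : rowInsert x X = (_, some x))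
        exact hxX (by rw [e]; simp)
      · have hL' := hL.miss hxf
        have hfL : f ∈ L.map Prod.snd := hL'.sub.subset (by simp)
        have hrL : r ∈ L.map Prod.snd := hL'.sub.subset (by simp)
        have hne : r ≠ x := by
          rintro rfl
          have h5 := (List.nodup_append.1 hn).2.1
          simp only [List.map_cons, List.nodup_cons] at h5
          exact h5.1 hrL
        have hlow : x < f → ∀ es : List ℕ, es.Sublist (L.map Prod.snd) →
            es.Pairwise (· > ·) → es.length = rs.length + 1 → ¬ ∀ e ∈ es, e < x := by
          intro hx es e1 e2 e3 e4
          have := hL.head_le (t := x) (ts := es) (e1.cons_cons _)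
            (List.pairwise_cons.2 ⟨e4, e2⟩) (by omega) (by simpa using e3)
          omega
        obtain ⟨τ, t1, t2⟩ := ihB (rowInsert x X).1 rs f r B a v hX1 hn1 hL' (next hL' hl) hv
          (by
            intro z hz
            rcases rowInsert_mem hz with rfl | hz
            · by_contra! hzr
              refine hlow (by omega) (r :: rs) ((List.sublist_cons_self _ _).trans hL'.sub)
                hd1.2 rfl ?_
              intro e he
              rcases List.mem_cons.1 he with rfl | he
              · omega
              · have := (List.pairwise_cons.1 hd1.2).1 e he
                omega
            · exact hgap z hz)
          (by
            intro z hz hzf es e1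
            rcases rowInsert_mem hz with rfl | hz
            · exact hlow hzf es e1
            · exact hI z hz hzf es (e1.cons _))
        refine ⟨τ, t1, ?_⟩
        rw [shift_cons_of_ne (p := (c, x)) hxf]
        exact t2.cons_same (o := (rowInsert x X).2) rfl rfl
          (fun h => hn2 f h (List.mem_append_right _ hfL))
          (fun y ys k1 k2 k3 => hb k1 k2 (k3.trans t1))

/-- One step of the Robinson–Schensted algorithm on a pair of tableaux. -/
noncomputable def rsStep (TR : List (List ℕ) × List (List ℕ)) (cv : ℕ × ℕ) :
    List (List ℕ) × List (List ℕ) :=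
  (tabInsert cv.2 TR.1, placeAt cv.1 (diffRow TR.1 (tabInsert cv.2 TR.1)) TR.2)

theorem rsPair_eq_foldl (P : Finset Cell) : rsPair P = (rsSteps P).foldl rsStep ([], []) := rfl

theorem length_rowInsert_none {v : ℕ} {X Y : List ℕ} (h : rowInsert v X = (Y, none)) :
    Y.length = X.length + 1 := by
  simpa [h] using (rowInsert_perm v X).length_eq

theorem length_rowInsert_some {v y : ℕ} {X Y : List ℕ} (h : rowInsert v X = (Y, some y)) :
    Y.length = X.length := by
  simpa [h] using (rowInsert_perm v X).length_eq

theorem exists_length_ne_tabInsert (v : ℕ) (T : List (List ℕ)) :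
    ∃ r, (T.getD r []).length ≠ ((tabInsert v T).getD r []).length := by
  induction T generalizing v with
  | nil => exact ⟨0, by simp [tabInsert]⟩
  | cons X T ih =>
    rcases h : rowInsert v X with ⟨Y, _ | y⟩
    · refine ⟨0, ?_⟩
      have := length_rowInsert_none h
      simp [tabInsert, h, this]
    · obtain ⟨r, hr⟩ := ih y
      exact ⟨r + 1, by simpa [tabInsert, h] using hr⟩

theorem diffRow_cons_of_length_ne {X X' : List ℕ} {T T' : List (List ℕ)}
    (h : X.length ≠ X'.length) : diffRow (X :: T) (X' :: T') = 0 :=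
  Nat.le_zero.1 (Nat.sInf_le (by simpa using h))

theorem diffRow_cons_of_length_eq {X X' : List ℕ} {T T' : List (List ℕ)}
    (h : X.length = X'.length) (hT : ∃ r, (T.getD r []).length ≠ (T'.getD r []).length) :
    diffRow (X :: T) (X' :: T') = diffRow T T' + 1 := by
  obtain ⟨r, hr⟩ := hT
  have h1 : 1 ≤ sInf {r | ((X :: T).getD r []).length ≠ ((X' :: T').getD r []).length} := by
    rw [Nat.one_le_iff_ne_zero, Ne, Nat.sInf_eq_zero]
    rintro (h0 | h0)
    · exact h0 (by simpa using h)
    · have : r + 1 ∈ {r | ((X :: T).getD r []).length ≠ ((X' :: T').getD r []).length} := by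
        simpa using hr
      rw [h0] at this
      exact this
  have h2 := Nat.sInf_add h1
  unfold diffRow
  rw [← h2]
  simp

theorem rsStep_cons_none {X Y R : List ℕ} {T Q : List (List ℕ)} {p : ℕ × ℕ}
    (h : rowInsert p.2 X = (Y, none)) :
    rsStep (X :: T, R :: Q) p = (Y :: T, (R ++ [p.1]) :: Q) := by
  have h1 : X.length ≠ Y.length := by rw [length_rowInsert_none h]; omega
  simp [rsStep, tabInsert, h, diffRow_cons_of_length_ne h1, placeAt]

theorem rsStep_cons_some {X Y R : List ℕ} {T Q : List (List ℕ)} {p : ℕ × ℕ} {y : ℕ}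
    (h : rowInsert p.2 X = (Y, some y)) :
    rsStep (X :: T, R :: Q) p =
      (Y :: (rsStep (T, Q) (p.1, y)).1, R :: (rsStep (T, Q) (p.1, y)).2) := by
  have h1 := (length_rowInsert_some h).symm
  simp [rsStep, tabInsert, h, diffRow_cons_of_length_eq h1 (exists_length_ne_tabInsert y T),
    placeAt]

theorem foldl_rsStep_cons (L : List (ℕ × ℕ)) (X R : List ℕ) (T Q : List (List ℕ)) :
    L.foldl rsStep (X :: T, R :: Q) =
      (finalRow X L :: ((bumps X L).foldl rsStep (T, Q)).1,
        (R ++ stays X L) :: ((bumps X L).foldl rsStep (T, Q)).2) := by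
  induction L generalizing X R T Q with
  | nil => simp [finalRow, bumps, stays]
  | cons p L ih =>
    rcases h : rowInsert p.2 X with ⟨Y, _ | y⟩
    · rw [List.foldl_cons, rsStep_cons_none h, ih, bumps_cons_none h]
      simp [finalRow, stays, h]
    · rw [List.foldl_cons, rsStep_cons_some h, ih, bumps_cons_some h]
      simp [finalRow, stays, h]

theorem foldl_rsStep_nil {L : List (ℕ × ℕ)} (hL : L ≠ []) :
    L.foldl rsStep ([], []) =
      (finalRow [] L :: ((bumps [] L).foldl rsStep ([], [])).1,
        stays [] L :: ((bumps [] L).foldl rsStep ([], [])).2) := by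
  have h := foldl_rsStep_cons L [] [] [] []
  rw [List.nil_append] at h
  rw [← h]
  cases L with
  | nil => exact absurd rfl hL
  | cons p L =>
    rw [List.foldl_cons, List.foldl_cons, rsStep_cons_none (Y := [p.2]) (by simp [rowInsert])]
    congr 1
    unfold rsStep
    rcases diffRow [] (tabInsert p.2 []) with _ | n <;> simp [tabInsert, placeAt]

theorem cols_bumps_sublist (X : List ℕ) (L : List (ℕ × ℕ)) :
    ((bumps X L).map Prod.fst).Sublist (L.map Prod.fst) := by
  induction L generalizing X with
  | nil => simp [bumps]
  | cons p L ih =>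
    rcases h : rowInsert p.2 X with ⟨Y, _ | y⟩
    · rw [bumps_cons_none h]
      exact (ih _).cons _
    · rw [bumps_cons_some h]
      exact (ih _).cons_cons _

theorem stays_eq_filter {X : List ℕ} {L : List (ℕ × ℕ)} (hL : (L.map Prod.fst).Nodup) :
    stays X L = (L.map Prod.fst).filter fun c => c ∉ (bumps X L).map Prod.fst := by
  induction L generalizing X with
  | nil => simp [stays]
  | cons p L ih =>
    rw [List.map_cons, List.nodup_cons] at hL
    rcases h : rowInsert p.2 X with ⟨Y, _ | y⟩
    · rw [bumps_cons_none h]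
      have hp : p.1 ∉ (bumps Y L).map Prod.fst := fun hm =>
        hL.1 ((cols_bumps_sublist _ _).subset hm)
      rw [List.map_cons, List.filter_cons_of_pos (by simpa using hp)]
      simp only [stays, h, ih hL.2]
      simp
    · rw [bumps_cons_some h, List.map_cons, List.map_cons, List.filter_cons_of_neg (by simp)]
      simp only [stays, h, ih hL.2]
      simp only [reduceCtorEq, if_false, List.nil_append]
      refine List.filter_congr fun c hc => ?_
      have : c ≠ p.1 := fun e => hL.1 (e ▸ hc)
      simp [this]

theorem bumps_append (X : List ℕ) (L M : List (ℕ × ℕ)) :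
    bumps X (L ++ M) = bumps X L ++ bumps (finalRow X L) M := by
  induction L generalizing X with
  | nil => simp [bumps, finalRow]
  | cons p L ih => simp [bumps, finalRow, ih]

theorem bumps_dropLast {X : List ℕ} {L : List (ℕ × ℕ)} {a v w : ℕ}
    (hc : (L.map Prod.fst).Nodup) (hl : L.getLast? = some (a, v))
    (hw : (bumps X L).getLast? = some (a, w)) : bumps X L.dropLast = (bumps X L).dropLast := by
  obtain ⟨M, rfl⟩ := List.getLast?_eq_some_iff.1 hl
  rw [List.dropLast_concat]
  rw [bumps_append] at hw ⊢
  rcases h : rowInsert v (finalRow X M) with ⟨Y, _ | y⟩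
  · rw [bumps_cons_none (p := (a, v)) h] at hw
    simp only [bumps, List.append_nil] at hw
    have h1 : a ∈ M.map Prod.fst := (cols_bumps_sublist X M).subset
      (List.mem_map.2 ⟨_, List.mem_of_getLast? hw, rfl⟩)
    rw [List.map_append, List.nodup_append] at hc
    exact absurd rfl (hc.2.2 a h1 a (by simp))
  · rw [bumps_cons_some (p := (a, v)) h]
    simp [bumps]

theorem cols_shift {rs : List ℕ} {M : List (ℕ × ℕ)} {a v : ℕ}
    (hs : rs.Sublist ((M ++ [(a, v)]).map Prod.snd)) (hv : v ∉ M.map Prod.snd)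
    (hl : rs.getLast? = some v) :
    (shift rs (M ++ [(a, v)])).map Prod.fst = M.map Prod.fst := by
  induction M generalizing rs with
  | nil =>
    rcases List.sublist_singleton.1 hs with rfl | rfl
    · simp at hl
    · simp [shift]
  | cons p M ih =>
    rw [List.map_cons, List.mem_cons, not_or] at hv
    cases rs with
    | nil => simp at hl
    | cons r rs =>
      rw [List.cons_append, List.map_cons] at hs
      rw [List.cons_append]
      by_cases hp : p.2 = r
      · subst hp
        cases rs with
        | nil => exact absurd (by simpa using hl.symm) hv.1
        | cons s rs =>
          obtain ⟨c, x⟩ := p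
          rw [shift_cons_cons_self, List.map_cons, List.map_cons,
            ih (List.cons_sublist_cons.1 hs) hv.2
              (by rwa [List.getLast?_cons_of_ne_nil (by simp)] at hl)]
      · rw [shift_cons_of_ne hp, List.map_cons, List.map_cons, ih ?_ hv.2 hl]
        rcases List.sublist_cons_iff.1 hs with h | ⟨l, h, -⟩
        · exact h
        · exact absurd (List.cons.inj h).1.symm hp

theorem filter_rowInsert {b v : ℕ} {X : List ℕ} (hX : X.Pairwise (· < ·)) (hb : ∀ x ∈ X, x ≤ b)
    (hv : v < b) :
    rowInsert v (X.filter (· ≠ b)) =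
      ((rowInsert v X).1.filter (· ≠ b), (rowInsert v X).2.filter (· ≠ b)) := by
  have small : ∀ A : List ℕ, (∀ x ∈ A, x ≤ v) → A.filter (· ≠ b) = A := fun A hA =>
    List.filter_eq_self.2 fun x hx => by have := hA x hx; simp; omega
  rcases rowInsert_cases v X with ⟨h1, h⟩ | ⟨A, y, C, rfl, h1, h2, h⟩
  · rw [h, small X h1, rowInsert_of_le h1, List.filter_append, small X h1]
    have : v ≠ b := by omega
    simp [this]
  · rw [h, List.filter_append, List.filter_append, small A h1]
    have hvb : v ≠ b := by omega
    by_cases hy : y = b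
    · subst hy
      have hC : C = [] := by
        refine List.eq_nil_iff_forall_not_mem.2 fun z hz => ?_
        have := hb z (by simp [hz])
        have := (List.pairwise_cons.1 (List.pairwise_append.1 hX).2.1).1 z hz
        omega
      subst hC
      simp [hvb, rowInsert_of_le h1, Option.filter]
    · simp [hvb, hy, rowInsert_bump _ h1 h2, Option.filter]

theorem filter_max {b : ℕ} {X : List ℕ} {L : List (ℕ × ℕ)} (hX : X.Pairwise (· < ·))
    (hn : (X ++ L.map Prod.snd).Nodup) (hb : ∀ x ∈ X ++ L.map Prod.snd, x ≤ b) :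
    finalRow (X.filter (· ≠ b)) (L.filter (·.2 ≠ b)) = (finalRow X L).filter (· ≠ b) ∧
      bumps (X.filter (· ≠ b)) (L.filter (·.2 ≠ b)) = (bumps X L).filter (·.2 ≠ b) := by
  induction L generalizing X with
  | nil => simp [finalRow, bumps]
  | cons p L ih =>
    have hp : p.2 ∉ X := by
      simp only [List.map_cons, List.nodup_append, List.mem_cons] at hn
      intro h
      exact hn.2.2 _ h _ (Or.inl rfl) rfl
    have hb1 : ∀ x ∈ (rowInsert p.2 X).1 ++ L.map Prod.snd, x ≤ b := by
      intro x hx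
      rcases List.mem_append.1 hx with hx | hx
      · rcases rowInsert_mem hx with rfl | hx
        · exact hb _ (by simp)
        · exact hb x (List.mem_append_left _ hx)
      · exact hb x (List.mem_append_right _ (List.mem_cons_of_mem _ hx))
    obtain ⟨ih1, ih2⟩ := ih (rowInsert_sorted hX hp) (nodup_step hn).1 hb1
    by_cases hpb : p.2 = b
    · have h1 : rowInsert p.2 X = (X ++ [b], none) := by
        rw [rowInsert_of_le (fun x hx => by rw [hpb]; exact hb x (List.mem_append_left _ hx)), hpb]
      rw [h1] at ih1 ih2
      have h2 : (X ++ [b]).filter (· ≠ b) = X.filter (· ≠ b) := by simp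
      rw [h2] at ih1 ih2
      rw [List.filter_cons_of_neg (by simpa using hpb), bumps_cons_none h1]
      exact ⟨by simpa [finalRow, h1] using ih1, ih2⟩
    · have h1 := filter_rowInsert hX (fun x hx => hb x (List.mem_append_left _ hx))
        (lt_of_le_of_ne (hb p.2 (by simp)) hpb)
      rw [List.filter_cons_of_pos (by simpa using hpb)]
      refine ⟨by simpa only [finalRow, h1] using ih1, ?_⟩
      simp only [bumps, h1, ih2, List.filter_append]
      congr 1
      cases (rowInsert p.2 X).2 with
      | none => simp
      | some y => by_cases hy : y = b <;> simp [hy]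

theorem exists_lead_bumps {b r a v : ℕ} {rs : List ℕ} {L : List (ℕ × ℕ)}
    (hn : (L.map Prod.snd).Nodup) (hb : ∀ x ∈ L.map Prod.snd, x ≤ b)
    (hL : IsLead (b + 1) (b :: r :: rs) (L.map Prod.snd)) (hl : L.getLast? = some (a, v))
    (hv : (b :: r :: rs).getLast? = some v) :
    ∃ τ, τ.length = rs.length ∧ Tracks a b [] [] L (shift (b :: r :: rs) L) τ ∧
      (∀ x ∈ (bumps [] L).map Prod.snd, x ≤ b) ∧
      IsLead (b + 1) (b :: τ) ((bumps [] L).map Prod.snd) := by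
  obtain ⟨τ, h1, h2⟩ := (exists_tracks L).2 [] rs b r (b + 1) a v (by simp) (by simpa using hn) hL
    hl hv (by simp) (by simp)
  have hp := perm_finalRow [] L
  have hW : ∀ x ∈ (bumps [] L).map Prod.snd, x ≤ b := fun x hx =>
    hb x (by simpa using hp.mem_iff.1 (List.mem_append_left _ hx))
  refine ⟨τ, h1, h2, hW, h2.sub, h2.dec, fun x hx => ?_, fun ts t1 t2 _ t4 => h2.min ts t1 t2 t4, ?_⟩
  · have := hW x (h2.sub.subset hx)
    omega
  · intro ts t1 t2 t3 t4
    cases ts with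
    | nil => simp at t4
    | cons t ts =>
      obtain ⟨es, e1, e2, e3, e4, e5⟩ :=
        exists_chain_of_bumps (X := []) (by simp) (by simpa using hn) t1 t2
      rcases e5 with e5 | e5
      · simp at e5
      · refine hL.short _ e5 (List.pairwise_cons.2 ⟨e4, e2⟩) ?_ ?_
        · intro x hx
          have := hb x (e5.subset hx)
          omega
        · simp only [List.length_cons] at t4 ⊢
          omega

theorem foldl_rsStep_shift (n : ℕ) {b a v : ℕ} {rs : List ℕ} {L : List (ℕ × ℕ)}
    (hrs : rs.length = n) (hc : (L.map Prod.fst).Nodup) (hn : (L.map Prod.snd).Nodup)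
    (hb : ∀ x ∈ L.map Prod.snd, x ≤ b) (hL : IsLead (b + 1) (b :: rs) (L.map Prod.snd))
    (hl : L.getLast? = some (a, v)) (hv : (b :: rs).getLast? = some v) :
    ((L.filter (·.2 ≠ b)).foldl rsStep ([], [])).1 =
        ((shift (b :: rs) L).foldl rsStep ([], [])).1 ∧
      (L.dropLast.foldl rsStep ([], [])).2 = ((shift (b :: rs) L).foldl rsStep ([], [])).2 := by
  induction n generalizing v rs L with
  | zero =>
    rw [List.length_eq_zero_iff] at hrs
    subst hrs
    obtain ⟨M, rfl⟩ := List.getLast?_eq_some_iff.1 hl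
    obtain rfl : b = v := by simpa using hv
    have hM : ∀ p ∈ M, p.2 ≠ b := by
      intro p hp e
      rw [List.map_append, List.nodup_append] at hn
      exact hn.2.2 p.2 (List.mem_map_of_mem hp) b (by simp) e
    have h1 : shift [b] (M ++ [(a, b)]) = M := by
      clear hc hn hb hL hl
      induction M with
      | nil => simp [shift]
      | cons p M ih =>
        rw [List.cons_append, shift_cons_of_ne (hM p (by simp)),
          ih fun q hq => hM q (by simp [hq])]
    have h2 : (M ++ [(a, b)]).filter (·.2 ≠ b) = M := by
      rw [List.filter_append, List.filter_eq_self.2 (by simpa using hM)]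
      simp
    rw [h1, h2, List.dropLast_concat]
    exact ⟨rfl, rfl⟩
  | succ n ih =>
    obtain ⟨r, rs, rfl⟩ : ∃ r rs', rs = r :: rs' := List.exists_cons_of_length_eq_add_one hrs
    obtain ⟨τ, t1, t2, hWb, hW⟩ := exists_lead_bumps hn hb hL hl hv
    have hp := perm_finalRow [] L
    rw [List.nil_append] at hp
    have hn' := List.nodup_append.1 (hp.nodup_iff.2 hn)
    obtain ⟨w, hw, hw'⟩ := t2.last
    have hcW := hc.sublist (cols_bumps_sublist [] L)
    obtain ⟨ih1, ih2⟩ := ih (by rw [t1]; simpa using hrs) hcW hn'.1 hWb hW hw hw'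
    have hbr : r < b := (List.pairwise_cons.1 hL.dec).1 r (by simp)
    have hcols : (shift (b :: r :: rs) L).map Prod.fst = L.dropLast.map Prod.fst := by
      obtain ⟨M, rfl⟩ := List.getLast?_eq_some_iff.1 hl
      rw [List.dropLast_concat]
      refine cols_shift hL.sub (fun h => ?_) hv
      rw [List.map_append, List.nodup_append] at hn
      exact hn.2.2 v h v (by simp) rfl
    have hcolsW : (shift (b :: τ) (bumps [] L)).map Prod.fst =
        (bumps [] L).dropLast.map Prod.fst := by
      have hnW := hn'.1
      have hsub := hW.sub
      obtain ⟨M, hM⟩ := List.getLast?_eq_some_iff.1 hw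
      rw [hM] at hnW hsub ⊢
      rw [List.dropLast_concat]
      refine cols_shift hsub (fun h => ?_) hw'
      rw [List.map_append, List.nodup_append] at hnW
      exact hnW.2.2 w h w (by simp) rfl
    have hdrop : L.dropLast ≠ [] := by
      have := hL.sub.length_le
      rw [← List.length_pos_iff]
      simp only [List.length_cons, List.length_map, List.length_dropLast] at this ⊢
      omega
    have hshift : shift (b :: r :: rs) L ≠ [] := by
      intro h
      rw [h] at hcols
      exact hdrop (List.map_eq_nil_iff.1 hcols.symm)
    have hfilter : L.filter (·.2 ≠ b) ≠ [] := by
      obtain ⟨p, hp1, hp2⟩ := List.mem_map.1 (hL.sub.subset (show r ∈ _ by simp))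
      exact List.ne_nil_of_mem (List.mem_filter.2 ⟨hp1, by simp; omega⟩)
    have hmax := filter_max (X := []) (L := L) (by simp) (by simpa using hn) (by simpa using hb)
    rw [List.filter_nil] at hmax
    have hfinal : (finalRow [] L).filter (· ≠ b) = finalRow [] L := by
      refine List.filter_eq_self.2 fun x hx => ?_
      have := hn'.2.2 b (hW.sub.subset (by simp)) x hx
      simpa using this.symm
    rw [foldl_rsStep_nil hshift, foldl_rsStep_nil hdrop, foldl_rsStep_nil hfilter, hmax.1, hmax.2,
      hfinal, t2.final, t2.bumps_eq, bumps_dropLast hc hl hw, ih1, ih2]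
    refine ⟨rfl, ?_⟩
    dsimp only
    rw [stays_eq_filter (hc.sublist ((List.dropLast_sublist _).map _)),
      stays_eq_filter (by rw [hcols]; exact hc.sublist ((List.dropLast_sublist _).map _)), hcols,
      t2.bumps_eq, hcolsW, bumps_dropLast hc hl hw]

theorem mem_shift {cs L : List (ℕ × ℕ)} (hs : cs.Sublist L) (hn : (L.map Prod.snd).Nodup)
    (p : ℕ × ℕ) : p ∈ shift (cs.map Prod.snd) L ↔
      (p ∈ L ∧ p ∉ cs) ∨ p ∈ List.zipWith (fun s t => (s.1, t.2)) cs cs.tail := by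
  induction L generalizing cs with
  | nil =>
    obtain rfl := List.sublist_nil.1 hs
    simp [shift]
  | cons q L ih =>
    rw [List.map_cons, List.nodup_cons] at hn
    have hq : q ∉ L := fun h => hn.1 (List.mem_map_of_mem h)
    cases cs with
    | nil => simp [shift]
    | cons s cs =>
      rcases List.sublist_cons_iff.1 hs with h | ⟨l, h, h'⟩
      · have hne : q.2 ≠ s.2 := fun e => hn.1 (e ▸ List.mem_map_of_mem (h.subset (by simp)))
        rw [List.map_cons, shift_cons_of_ne hne, ← List.map_cons (f := Prod.snd), List.mem_cons,
          ih h hn.2]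
        have : p = q → p ∉ s :: cs := by
          rintro rfl h2
          exact hq (h.subset h2)
        have hm : p ∈ q :: L ↔ p = q ∨ p ∈ L := List.mem_cons
        rw [hm]
        generalize (p ∈ s :: cs) = A at *
        generalize (p = q) = B at *
        tauto
      · obtain ⟨rfl, rfl⟩ := List.cons.inj h
        have hps : p ∈ L → ¬ p = s := by
          rintro h1 rfl
          exact hq h1
        cases cs with
        | nil =>
          obtain ⟨c, r⟩ := s
          simp only [List.map_cons, List.map_nil, shift_singleton_self, List.mem_cons,
            List.tail_cons, List.zipWith_nil_right, List.not_mem_nil]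
          tauto
        | cons t cs =>
          obtain ⟨c, r⟩ := s
          have ih' := ih h' hn.2
          simp only [List.map_cons, shift_cons_cons_self, List.mem_cons, List.tail_cons,
            List.zipWith_cons_cons] at ih' ⊢
          rw [ih']
          constructor
          · rintro (h1 | ⟨h1, h2⟩ | h1)
            · exact Or.inr (Or.inl h1)
            · exact Or.inl ⟨Or.inr h1, fun h => h.elim (hps h1) h2⟩
            · exact Or.inr (Or.inr h1)
          · rintro (⟨h1 | h1, h2⟩ | h1 | h1)
            · exact absurd (Or.inl h1) h2
            · exact Or.inr (Or.inl ⟨h1, fun h => h2 (Or.inr h)⟩)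
            · exact Or.inl h1
            · exact Or.inr (Or.inr h1)

theorem sublist_of_subset_of_fst_lt {cs L : List Cell} (hcs : cs.Pairwise (·.1 < ·.1))
    (hL : L.Pairwise (·.1 < ·.1)) (h : cs ⊆ L) : cs.Sublist L := by
  have : Std.Antisymm (fun p q : Cell => p.1 < q.1) := ⟨fun _ _ h h' => absurd h h'.asymm⟩
  refine List.sublist_of_subperm_of_pairwise (List.subperm_of_subset ?_ h) hcs hL
  exact hcs.imp fun h e => h.ne (congrArg Prod.fst e)

theorem getLast?_of_fst_le {L : List Cell} {p : Cell} (hL : L.Pairwise (·.1 < ·.1)) (hp : p ∈ L)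
    (h : ∀ q ∈ L, q.1 ≤ p.1) : L.getLast? = some p := by
  rcases List.eq_nil_or_concat L with rfl | ⟨M, q, rfl⟩
  · simp at hp
  · simp only [List.concat_eq_append, List.mem_append, List.mem_singleton,
      List.pairwise_append] at *
    rcases hp with hp | rfl
    · have h1 := hL.2.2 p hp q rfl
      have h2 := h q (Or.inr rfl)
      omega
    · simp

theorem rowAt_eq {P : Finset Cell} (hP : ∀ p ∈ P, ∀ q ∈ P, p.1 = q.1 → p = q) {p : Cell}
    (hp : p ∈ P) : rowAt P p.1 = p.2 := by
  have : {r | (p.1, r) ∈ P} = {p.2} := by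
    ext r
    constructor
    · intro hr
      exact congrArg Prod.snd (hP _ hr _ hp rfl)
    · rintro rfl
      exact hp
  rw [rowAt, this, csSup_singleton]

theorem rsSteps_eq {P : Finset Cell} {L : List Cell} (hL : L.Pairwise (·.1 < ·.1))
    (h : ∀ p, p ∈ L ↔ p ∈ P) : rsSteps P = L := by
  have hP : ∀ p ∈ P, ∀ q ∈ P, p.1 = q.1 → p = q := by
    intro p hp q hq hpq
    have h1 : (L.map Prod.fst).Nodup := List.pairwise_map.2 (hL.imp fun h => h.ne)
    exact List.inj_on_of_nodup_map h1 ((h p).2 hp) ((h q).2 hq) hpq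
  have h1 : P.image Prod.fst = (L.map Prod.fst).toFinset := by
    ext c
    simp [h]
  have h2 : (L.map Prod.fst).Pairwise (· < ·) := List.pairwise_map.2 hL
  rw [rsSteps, h1, (List.toFinset_sort (r := (· ≤ ·)) (h2.imp fun h => h.ne)).2
    (h2.imp fun h => h.le), List.map_map]
  conv_rhs => rw [← List.map_id L]
  exact List.map_congr_left fun p hp => Prod.ext rfl (rowAt_eq hP ((h p).1 hp))

theorem pairwise_rsSteps (P : Finset Cell) : (rsSteps P).Pairwise (·.1 < ·.1) :=
  List.pairwise_map.2 (Finset.sortedLT_sort _).pairwise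

theorem mem_rsSteps {P : Finset Cell} (hP : ∀ p ∈ P, ∀ q ∈ P, p.1 = q.1 → p = q) (p : Cell) :
    p ∈ rsSteps P ↔ p ∈ P := by
  simp only [rsSteps, List.mem_map, Finset.mem_sort, Finset.mem_image]
  constructor
  · rintro ⟨_, ⟨q, hq, rfl⟩, rfl⟩
    rwa [rowAt_eq hP hq]
  · intro hp
    exact ⟨p.1, ⟨p, hp, rfl⟩, by rw [rowAt_eq hP hp]⟩

theorem lexLE_of_rowLexLE {k : ℕ} {S T : Fin k → Cell} (h : rowLexLE k S T) :
    LexLE ((List.ofFn S).map Prod.snd) ((List.ofFn T).map Prod.snd) := by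
  induction k with
  | zero => simp [LexLE]
  | succ k ih =>
    simp only [List.ofFn_succ, List.map_cons, LexLE]
    rcases h with h | ⟨i, h1, h2⟩
    · exact Or.inr ⟨h 0, ih (Or.inl fun i => h i.succ)⟩
    · cases i using Fin.cases with
      | zero => exact Or.inl h1
      | succ i =>
        exact Or.inr ⟨h2 0 (Fin.succ_pos i),
          ih (Or.inr ⟨i, h1, fun j hj => h2 j.succ (Fin.succ_lt_succ_iff.2 hj)⟩)⟩

theorem mem_zipWith_ofFn {k : ℕ} {S : Fin k → Cell} {p : Cell} :
    p ∈ List.zipWith (fun s t => (s.1, t.2)) (List.ofFn S) (List.ofFn S).tail ↔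
      ∃ (i : ℕ) (h : i + 1 < k), p = ((S ⟨i, by omega⟩).1, (S ⟨i + 1, h⟩).2) := by
  rw [List.mem_iff_getElem]
  constructor
  · rintro ⟨i, hi, rfl⟩
    simp only [List.length_zipWith, List.length_ofFn, List.length_tail] at hi
    exact ⟨i, by omega, by simp⟩
  · rintro ⟨i, hi, rfl⟩
    exact ⟨i, by simp; omega, by simp⟩

section Placement

variable {m : ℕ} {F P : Finset Cell} {S : Fin (m + 1) → Cell}

theorem mem_chain_rect (hS : IsDecSeq P (m + 1) S) (hpos : ∀ p ∈ P, 1 ≤ p.1 ∧ 1 ≤ p.2)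
    (i : Fin (m + 1)) : S i ∈ Rect (S (Fin.last m)).1 (S 0).2 := by
  have h1 : (S i).1 ≤ (S (Fin.last m)).1 := by
    rcases (Fin.le_last i).lt_or_eq with h | h
    · exact (hS.2 _ _ h).1.le
    · rw [h]
  have h2 : (S i).2 ≤ (S 0).2 := by
    rcases (Fin.zero_le i).lt_or_eq with h | h
    · exact (hS.2 _ _ h).2.le
    · rw [h]
  have h3 := hpos _ (hS.1 i)
  simp only [Rect, Finset.mem_product, Finset.mem_Icc]
  exact ⟨⟨h3.1, h1⟩, h3.2, h2⟩

theorem isLead_of_isMinOcc (hS : IsMinOcc F P (m + 1) S)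
    {L : List Cell} (hL : L.Pairwise (·.1 < ·.1))
    (hmem : ∀ p, p ∈ L ↔ p ∈ P ∩ Rect (S (Fin.last m)).1 (S 0).2)
    (hsub : (List.ofFn S).Sublist L) :
    IsLead ((S 0).2 + 1) ((List.ofFn S).map Prod.snd) (L.map Prod.snd) := by
  obtain ⟨⟨hdec, a', b', hF', hrect⟩, hmin⟩ := hS
  have hbL : ∀ x ∈ L.map Prod.snd, x ≤ (S 0).2 := by
    intro x hx
    obtain ⟨p, hp, rfl⟩ := List.mem_map.1 hx
    have := (Finset.mem_inter.1 ((hmem p).1 hp)).2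
    simp only [Rect, Finset.mem_product, Finset.mem_Icc] at this
    exact this.2.2
  have hRect : Rect (S (Fin.last m)).1 (S 0).2 ⊆ F := by
    refine Finset.Subset.trans ?_ hF'
    have h1 := hrect (Fin.last m)
    have h2 := hrect 0
    simp only [Rect, Finset.mem_product, Finset.mem_Icc] at h1 h2
    exact Finset.product_subset_product (Finset.Icc_subset_Icc_right h1.1.2)
      (Finset.Icc_subset_Icc_right h2.2.2)
  have key : ∀ ts : List ℕ, ts.Sublist (L.map Prod.snd) → ts.Pairwise (· > ·) →
      ts.length = m + 1 → LexLE ((List.ofFn S).map Prod.snd) ts := by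
    intro ts h1 h2 h3
    obtain ⟨ps, hps, rfl⟩ := List.sublist_map_iff.1 h1
    rw [List.length_map] at h3
    obtain ⟨T, rfl⟩ : ∃ T : Fin (m + 1) → Cell, ps = List.ofFn T :=
      ⟨fun i => ps[i.1]'(by omega), List.ext_getElem (by simp [h3]) (by simp [-List.ofFn_succ])⟩
    have hT : ∀ i, T i ∈ P ∩ Rect (S (Fin.last m)).1 (S 0).2 := fun i =>
      (hmem _).1 (hps.subset (List.mem_ofFn.2 ⟨i, rfl⟩))
    have h4 := List.pairwise_ofFn.1 (hL.sublist hps)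
    have h5 := List.pairwise_ofFn.1 (List.pairwise_map.1 h2)
    refine lexLE_of_rowLexLE (hmin T ⟨⟨fun i => (Finset.mem_inter.1 (hT i)).1, fun i j hij => ?_⟩,
      _, _, hRect, fun i => (Finset.mem_inter.1 (hT i)).2⟩)
    exact ⟨h4 hij, h5 hij⟩
  refine ⟨hsub.map _, ?_, ?_, ?_, ?_⟩
  · exact List.pairwise_map.2 (List.pairwise_ofFn.2 fun i j hij => (hdec.2 i j hij).2)
  · intro r hr
    have := hbL r ((hsub.map _).subset hr)
    omega
  · intro ts h1 h2 _ h4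
    exact key ts h1 h2 (by simpa using h4)
  · intro ts h1 h2 _ h4
    cases ts with
    | nil => simp at h4
    | cons t ts =>
      have h5 := List.pairwise_cons.1 h2
      have h6 := key ts ((List.sublist_cons_self _ _).trans h1) h5.2 (by simpa using h4)
      cases ts with
      | nil => simp at h4
      | cons u us =>
        rw [List.ofFn_succ, List.map_cons] at h6
        have h7 := h6.head_le
        have h8 := h5.1 u (by simp)
        have h9 := hbL t (h1.subset (by simp))
        omega

theorem rsSteps_phiStep_inter {L : List Cell}
    (hL : L.Pairwise (·.1 < ·.1)) (hn : (L.map Prod.snd).Nodup)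
    (hmem : ∀ p, p ∈ L ↔ p ∈ P ∩ Rect (S (Fin.last m)).1 (S 0).2)
    (hsub : (List.ofFn S).Sublist L) (hl : L.getLast? = some (S (Fin.last m)))
    {R : Finset Cell} (hR : R ⊆ Rect (S (Fin.last m)).1 (S 0).2)
    (hcorner : ((S (Fin.last m)).1, (S 0).2) ∉ R)
    (hout : ∀ p ∈ L, p ∉ List.ofFn S → p ∈ R)
    (hshift : ∀ (i : ℕ) (h : i + 1 < m + 1),
      ((S ⟨i, by omega⟩).1, (S ⟨i + 1, h⟩).2) ∈ R) :
    rsSteps (phiStep (m + 1) S P ∩ R) = shift ((List.ofFn S).map Prod.snd) L := by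
  refine rsSteps_eq ?_ fun p => ?_
  · rw [← List.pairwise_map (f := Prod.fst) (R := (· < ·))]
    obtain ⟨M, rfl⟩ := List.getLast?_eq_some_iff.1 hl
    have h1 : (S (Fin.last m)).2 ∉ M.map Prod.snd := by
      intro h
      rw [List.map_append, List.nodup_append] at hn
      exact hn.2.2 _ h _ (by simp) rfl
    have h2 := cols_shift (a := (S (Fin.last m)).1) (v := (S (Fin.last m)).2) (hsub.map Prod.snd) h1
      (by simp [List.getLast?_eq_getElem?, Fin.last, -List.ofFn_succ])
    rw [h2]
    exact List.pairwise_map.2 (List.pairwise_append.1 hL).1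
  · rw [mem_shift hsub hn, mem_zipWith_ofFn, phiStep]
    simp only [Finset.mem_inter, Finset.mem_union, Finset.mem_sdiff, Finset.mem_image,
      Finset.mem_univ, true_and, List.mem_ofFn] at hmem hout ⊢
    constructor
    · rintro (⟨h1, h2⟩ | ⟨i, hi, rfl⟩)
      · exact ⟨Or.inl ⟨((hmem p).1 h1).1, h2⟩, hout p h1 h2⟩
      · refine ⟨Or.inr ⟨⟨i, by omega⟩, ?_⟩, hshift i hi⟩
        simp [cyc, Nat.mod_eq_of_lt hi]
    · rintro ⟨⟨h1, h2⟩ | ⟨i, rfl⟩, h3⟩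
      · exact Or.inl ⟨(hmem p).2 ⟨h1, hR h3⟩, h2⟩
      · by_cases hi : i.1 + 1 < m + 1
        · refine Or.inr ⟨i, hi, ?_⟩
          simp [cyc, Nat.mod_eq_of_lt hi]
        · have hi' : i = Fin.last m := Fin.ext (by simp; omega)
          subst hi'
          have : cyc (m + 1) (Fin.last m) = 0 := Fin.ext (by simp [cyc])
          rw [this] at h3
          exact absurd h3 hcorner

theorem insTab_recTab_phiStep (hF : IsFerrers F) (hP : IsPlacement F P)
    (hS : IsMinOcc F P (m + 1) S) :
    insTab (P ∩ Rect (S (Fin.last m)).1 ((S 0).2 - 1)) =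
        insTab (phiStep (m + 1) S P ∩ Rect (S (Fin.last m)).1 ((S 0).2 - 1)) ∧
      recTab (P ∩ Rect ((S (Fin.last m)).1 - 1) (S 0).2) =
        recTab (phiStep (m + 1) S P ∩ Rect ((S (Fin.last m)).1 - 1) (S 0).2) := by
  have hpos : ∀ p ∈ P, 1 ≤ p.1 ∧ 1 ≤ p.2 := fun p hp =>
    ⟨(hF p (hP.1 hp)).1, (hF p (hP.1 hp)).2.1⟩
  have hdec := hS.1.1
  have hSr := mem_chain_rect hdec hpos
  set a := (S (Fin.last m)).1 with ha
  set b := (S 0).2 with hb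
  obtain ⟨L, hLdef⟩ : ∃ L, L = rsSteps (P ∩ Rect a b) := ⟨_, rfl⟩
  have hL : L.Pairwise (·.1 < ·.1) := hLdef ▸ pairwise_rsSteps _
  have hmem : ∀ p, p ∈ L ↔ p ∈ P ∩ Rect a b := by
    rw [hLdef]
    exact mem_rsSteps fun p hp q hq =>
      hP.2.1 p (Finset.mem_inter.1 hp).1 q (Finset.mem_inter.1 hq).1
  have hmem' : ∀ p, p ∈ L ↔ p ∈ P ∧ (1 ≤ p.1 ∧ p.1 ≤ a) ∧ 1 ≤ p.2 ∧ p.2 ≤ b := by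
    simpa [Rect] using hmem
  have hc : (L.map Prod.fst).Nodup := List.pairwise_map.2 (hL.imp fun h => h.ne)
  have hn : (L.map Prod.snd).Nodup := by
    refine List.pairwise_map.2 (hL.imp_of_mem fun hp hq h e => ?_)
    exact h.ne (congrArg Prod.fst (hP.2.2 _ ((hmem' _).1 hp).1 _ ((hmem' _).1 hq).1 e))
  have hsub : (List.ofFn S).Sublist L := by
    refine sublist_of_subset_of_fst_lt
      (List.pairwise_ofFn.2 fun i j hij => (hdec.2 i j hij).1) hL fun p hp => ?_
    obtain ⟨i, rfl⟩ := List.mem_ofFn.1 hp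
    exact (hmem _).2 (Finset.mem_inter.2 ⟨hdec.1 i, hSr i⟩)
  have hSL : ∀ i, S i ∈ L := fun i => hsub.subset (List.mem_ofFn.2 ⟨i, rfl⟩)
  have hl : L.getLast? = some (S (Fin.last m)) :=
    getLast?_of_fst_le hL (hSL _) fun q hq => ((hmem' q).1 hq).2.1.2
  have hv : ((List.ofFn S).map Prod.snd).getLast? = some (S (Fin.last m)).2 := by
    simp [List.getLast?_eq_getElem?, Fin.last, -List.ofFn_succ]
  have hlead := isLead_of_isMinOcc hS hL hmem hsub
  have hSb := (hmem' _).1 (hSL 0)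
  have hSa := (hmem' _).1 (hSL (Fin.last m))
  have hsame : ∀ p ∈ L, p ∉ List.ofFn S → p.1 ≠ a ∧ p.2 ≠ b := by
    intro p hp hpS
    refine ⟨fun e => hpS ?_, fun e => hpS ?_⟩
    · rw [hP.2.1 p ((hmem' p).1 hp).1 _ (hdec.1 (Fin.last m)) e]
      exact List.mem_ofFn.2 ⟨_, rfl⟩
    · rw [hP.2.2 p ((hmem' p).1 hp).1 _ (hdec.1 0) e]
      exact List.mem_ofFn.2 ⟨_, rfl⟩
  have hstep : ∀ (i : ℕ) (h : i + 1 < m + 1),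
      (S ⟨i, by omega⟩).1 < a ∧ (S ⟨i + 1, h⟩).2 < b := by
    intro i h
    refine ⟨(hdec.2 _ _ ?_).1, (hdec.2 _ _ ?_).2⟩
    · simp only [Fin.lt_def, Fin.val_last]; omega
    · simp [Fin.lt_def]
  have e1 : rsSteps (P ∩ Rect a (b - 1)) = L.filter (·.2 ≠ b) := by
    refine rsSteps_eq (hL.filter _) fun p => ?_
    simp only [List.mem_filter, hmem', decide_eq_true_eq, Finset.mem_inter, Rect,
      Finset.mem_product, Finset.mem_Icc]
    constructor
    · rintro ⟨⟨h1, h2, h3⟩, h4⟩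
      exact ⟨h1, h2, by omega⟩
    · rintro ⟨h1, h2, h3⟩
      exact ⟨⟨h1, h2, by omega⟩, by omega⟩
  have e2 : rsSteps (P ∩ Rect (a - 1) b) = L.dropLast := by
    refine rsSteps_eq (hL.sublist (List.dropLast_sublist _)) fun p => ?_
    obtain ⟨M, hM⟩ := List.getLast?_eq_some_iff.1 hl
    have h1 := hmem' p
    rw [hM, List.mem_append, List.mem_singleton] at h1
    rw [hM, List.pairwise_append] at hL
    rw [hM, List.dropLast_concat]
    simp only [Finset.mem_inter, Rect, Finset.mem_product, Finset.mem_Icc]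
    constructor
    · intro hp
      have h2 := hL.2.2 p hp (S (Fin.last m)) (by simp)
      have h3 := h1.1 (Or.inl hp)
      exact ⟨h3.1, by omega, h3.2.2⟩
    · rintro ⟨h2, h3, h4⟩
      rcases h1.2 ⟨h2, by omega, h4⟩ with h5 | h5
      · exact h5
      · rw [h5] at h3
        omega
  have e3 : rsSteps (phiStep (m + 1) S P ∩ Rect a (b - 1)) =
      shift ((List.ofFn S).map Prod.snd) L := by
    refine rsSteps_phiStep_inter hL hn hmem hsub hl ?_ ?_ ?_ ?_
    · exact Finset.product_subset_product_right (Finset.Icc_subset_Icc_right (by omega))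
    · simp only [Rect, Finset.mem_product, Finset.mem_Icc]
      omega
    · intro p hp hpS
      have h1 := (hmem' p).1 hp
      have h2 := hsame p hp hpS
      simp only [Rect, Finset.mem_product, Finset.mem_Icc]
      omega
    · intro i h
      have h1 := hstep i h
      have h2 := (hmem' _).1 (hSL ⟨i, by omega⟩)
      have h3 := (hmem' _).1 (hSL ⟨i + 1, h⟩)
      simp only [Rect, Finset.mem_product, Finset.mem_Icc]
      omega
  have e4 : rsSteps (phiStep (m + 1) S P ∩ Rect (a - 1) b) =
      shift ((List.ofFn S).map Prod.snd) L := by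
    refine rsSteps_phiStep_inter hL hn hmem hsub hl ?_ ?_ ?_ ?_
    · exact Finset.product_subset_product_left (Finset.Icc_subset_Icc_right (by omega))
    · simp only [Rect, Finset.mem_product, Finset.mem_Icc]
      omega
    · intro p hp hpS
      have h1 := (hmem' p).1 hp
      have h2 := hsame p hp hpS
      simp only [Rect, Finset.mem_product, Finset.mem_Icc]
      omega
    · intro i h
      have h1 := hstep i h
      have h2 := (hmem' _).1 (hSL ⟨i, by omega⟩)
      have h3 := (hmem' _).1 (hSL ⟨i + 1, h⟩)
      simp only [Rect, Finset.mem_product, Finset.mem_Icc]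
      omega
  rw [insTab, insTab, recTab, recTab, rsPair_eq_foldl, rsPair_eq_foldl, rsPair_eq_foldl,
    rsPair_eq_foldl, e1, e2, e3, e4]
  rw [List.ofFn_succ, List.map_cons] at hlead hv ⊢
  refine foldl_rsStep_shift _ rfl hc hn (fun x hx => ?_) hlead hl hv
  obtain ⟨p, hp, rfl⟩ := List.mem_map.1 hx
  exact ((hmem' p).1 hp).2.2.2

end Placement

/-- **Lemma.** Fix `k ≥ 2`, let `S` be the value-smallest occurrence of `k…1` in the
placement `P` on the Ferrers board `F`, and set `b = row(S₁)`, `a = col(S_k)`. Then for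
`R₁ = R(a, b-1)` we have `ins(P|_{R₁}) = ins(φ(P)|_{R₁})`, and for `R₂ = R(a-1, b)` we
have `rec(P|_{R₂}) = rec(φ(P)|_{R₂})`. -/
theorem ins_rec_phi_restriction (k : ℕ) (hk : 2 ≤ k) (F P : Finset Cell)
    (hF : IsFerrers F) (hP : IsPlacement F P)
    (S : Fin k → Cell) (hS : IsMinOcc F P k S)
    (a b : ℕ) (ha : a = (S ⟨k - 1, by omega⟩).1) (hb : b = (S ⟨0, by omega⟩).2) :
    insTab (P ∩ Rect a (b - 1)) = insTab (phiStep k S P ∩ Rect a (b - 1)) ∧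
      recTab (P ∩ Rect (a - 1) b) = recTab (phiStep k S P ∩ Rect (a - 1) b) := by
  obtain ⟨m, rfl⟩ : ∃ m, k = m + 1 := ⟨k - 1, by omega⟩
  subst ha hb
  exact insTab_recTab_phiStep hF hP hS
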